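/- arXiv:2005.09249 — 3 statements merged into one kernel-verified Lean document; each statement's English description precedes it below -/
import Mathlib

section
/- Let T be an RTT family of size n with parameter c in a ℂ-algebra A, and define the transfer matrix 𝔱(u) = Σ_{i=1}^{n} T_{i,i}(u). Then for all complex u, v one has 𝔱(u)·𝔱(v) = 𝔱(v)·𝔱(u). -/
open scoped BigOperators

/-- An RTT family with parameter `c` in a ℂ-algebra `A`. -/
def IsRTTFamily {A : Type*} [Ring A] [Algebra ℂ A] (c : ℂ) (n : ℕ)
    (T : ℂ → Fin n → Fin n → A) : Prop :=
  ∀ u v : ℂ, u ≠ v → ∀ i j k l : Fin n,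
    T u i j * T v k l - T v k l * T u i j =
      (c / (u - v)) • (T u i l * T v k j - T v i l * T u k j)

/-- The commutator of two transfer matrices, as a multiple of an expression antisymmetric in the
spectral parameters. -/
theorem IsRTTFamily.commutator_transfer {A : Type*} [Ring A] [Algebra ℂ A] {c : ℂ} {n : ℕ}
    {T : ℂ → Fin n → Fin n → A} (hT : IsRTTFamily c n T) {u v : ℂ} (h : u ≠ v) :
    (∑ i, T u i i) * (∑ i, T v i i) - (∑ i, T v i i) * (∑ i, T u i i) =
      (c / (u - v)) • (∑ i, ∑ k, T u i k * T v k i - ∑ i, ∑ k, T v i k * T u k i) := by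
  rw [Finset.sum_mul_sum, Finset.sum_mul_sum, Finset.sum_comm (f := fun i k => T v i i * T u k k)]
  simp only [← Finset.sum_sub_distrib, Finset.smul_sum]
  exact Finset.sum_congr rfl fun i _ => Finset.sum_congr rfl fun k _ => hT u v h i i k k

/-- transfer matrices commute. -/
theorem transfer_matrices_commute
    {A : Type*} [Ring A] [Algebra ℂ A] (c : ℂ) (hc : c ≠ 0) (n : ℕ) (hn : 1 ≤ n)
    (T : ℂ → Fin n → Fin n → A) (hT : IsRTTFamily c n T) :
    ∀ u v : ℂ, (∑ i : Fin n, T u i i) * (∑ i : Fin n, T v i i) =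
      (∑ i : Fin n, T v i i) * (∑ i : Fin n, T u i i) := by
  intro u v
  rcases eq_or_ne u v with rfl | h
  · rfl
  have : IsAddTorsionFree A := .of_isTorsionFree ℂ A
  have huv := hT.commutator_transfer h
  have hvu := hT.commutator_transfer h.symm
  rw [← neg_sub u v, div_neg, neg_smul, ← smul_neg, neg_sub, ← huv] at hvu
  exact sub_eq_zero.mp (self_eq_neg.mp (hvu.symm.trans (neg_sub _ _).symm))
end

section
/- Shift property of the Izergin determinant: let p ≥ 0 and let x̄ = (x_1,…,x_p), ȳ = (y_1,…,y_p) be tuples of complex numbers, each with pairwise distinct entries, such that x_a − y_b ∉ {0, c, −c} for all a, b. Then K(x̄ − c | ȳ) = (−1)^p · K(ȳ | x̄) / f(ȳ, x̄), where x̄ − c = (x_1 − c, …, x_p − c). -/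
open scoped BigOperators

/-- The product `f(ū,v̄) = Π_{i,j} f(u_i,v_j)` with `f(u,v) = (u-v+c)/(u-v)`. -/
noncomputable def fProd (c : ℂ) {p q : ℕ} (u : Fin p → ℂ) (v : Fin q → ℂ) : ℂ :=
  ∏ i, ∏ j, (u i - v j + c) / (u i - v j)

/-- The Izergin determinant `K(ȳ|x̄)` with parameter `c`. -/
noncomputable def izK (c : ℂ) {p : ℕ} (y x : Fin p → ℂ) : ℂ :=
  (∏ i : Fin p, ∏ j : Fin p, if i < j then c / (y j - y i) else 1) *
  (∏ i : Fin p, ∏ j : Fin p, if i < j then c / (x i - x j) else 1) *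
  (∏ i : Fin p, ∏ j : Fin p, (y i - x j + c) / c) *
  Matrix.det (Matrix.of fun i j : Fin p => (c / (y i - x j)) / ((y i - x j + c) / c))

/-- Exchanging the two tuples leaves the Vandermonde-type prefactor unchanged. -/
lemma prod_antisymm_mul_comm (c : ℂ) {p : ℕ} (x y : Fin p → ℂ) :
    (∏ i : Fin p, ∏ j : Fin p, if i < j then c / (x j - x i) else 1) *
      (∏ i : Fin p, ∏ j : Fin p, if i < j then c / (y i - y j) else 1) =
    (∏ i : Fin p, ∏ j : Fin p, if i < j then c / (y j - y i) else 1) *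
      (∏ i : Fin p, ∏ j : Fin p, if i < j then c / (x i - x j) else 1) := by
  simp only [← Finset.prod_mul_distrib]
  refine Finset.prod_congr rfl fun i _ => Finset.prod_congr rfl fun j _ => ?_
  split_ifs
  · rw [← neg_sub (x i), ← neg_sub (y j), div_neg, div_neg, neg_mul_neg, mul_comm]
  · rfl

/-- Reversing all differences in a `p × p` product costs the sign `(-1) ^ p`. -/
lemma prod_sub_div_swap (c : ℂ) {p : ℕ} (x y : Fin p → ℂ) :
    ∏ i, ∏ j, (x i - y j) / c = (-1) ^ p * ∏ i, ∏ j, (y i - x j) / c := by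
  have h (i j : Fin p) : (x i - y j) / c = -1 * ((y j - x i) / c) := by ring
  have hsign : ((-1 : ℂ) ^ p) ^ p = (-1) ^ p := by
    rcases Nat.even_or_odd p with hp | hp
    · simp [hp.neg_one_pow]
    · simp [hp.neg_one_pow]
  simp only [h, Finset.prod_mul_distrib, Finset.prod_const, Finset.card_univ, Fintype.card_fin,
    hsign]
  rw [Finset.prod_comm]

/-- The determinants of `K(x̄ − c | ȳ)` and `K(ȳ | x̄)` agree, by transposition. -/
lemma det_izK_shift (c : ℂ) {p : ℕ} (x y : Fin p → ℂ) :
    Matrix.det (Matrix.of fun i j : Fin p =>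
      (c / (x i - c - y j)) / ((x i - c - y j + c) / c)) =
    Matrix.det (Matrix.of fun i j : Fin p => (c / (y i - x j)) / ((y i - x j + c) / c)) := by
  rw [← Matrix.det_transpose]
  congr 1
  ext i j
  simp only [Matrix.transpose_apply, Matrix.of_apply]
  rw [show x j - c - y i = -(y i - x j + c) by ring,
    show -(y i - x j + c) + c = -(y i - x j) by ring, div_div_eq_mul_div, div_div_eq_mul_div,
    div_neg, div_neg, neg_mul, neg_div, neg_neg, div_mul_eq_mul_div, div_mul_eq_mul_div,
    div_right_comm]

/-- Dividing the product of the `h(y_i, x_j)` by `f(ȳ, x̄)` leaves that of the `1 / g(y_i, x_j)`. -/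
lemma prod_div_fProd (c : ℂ) {p q : ℕ} (y : Fin p → ℂ) (x : Fin q → ℂ)
    (h : ∀ i j, y i - x j + c ≠ 0) :
    (∏ i, ∏ j, (y i - x j + c) / c) / fProd c y x = ∏ i, ∏ j, (y i - x j) / c := by
  simp only [fProd, ← Finset.prod_div_distrib]
  refine Finset.prod_congr rfl fun i _ => Finset.prod_congr rfl fun j _ => ?_
  rw [div_div_div_eq, mul_comm c, mul_div_mul_left _ _ (h i j)]

/-- shift property of the Izergin determinant:
`K(x̄ − c | ȳ) = (−1)^p · K(ȳ|x̄) / f(ȳ,x̄)`. -/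
theorem izK_shift (c : ℂ) (hc : c ≠ 0) (p : ℕ)
    (x y : Fin p → ℂ) (hx : Function.Injective x) (hy : Function.Injective y)
    (hxy : ∀ a b, x a - y b ≠ 0 ∧ x a - y b ≠ c ∧ x a - y b ≠ -c) :
    izK c (fun i => x i - c) y = (-1) ^ p * izK c y x / fProd c y x := by
  have hne (i j : Fin p) : y i - x j + c ≠ 0 := fun h =>
    (hxy j i).2.1 (by linear_combination -h)
  have hh : ∏ i, ∏ j, (x i - c - y j + c) / c = ∏ i, ∏ j, (x i - y j) / c := by
    simp only [sub_right_comm _ c, sub_add_cancel]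
  unfold izK
  rw [det_izK_shift, hh, prod_sub_div_swap, ← prod_div_fProd c y x hne]
  simp only [sub_sub_sub_cancel_right]
  rw [prod_antisymm_mul_comm]
  ring
end

section
/- Diagonal limit of the Izergin determinant: let p ≥ 1 and let ȳ = (y_1,…,y_p) be a tuple of complex numbers with pairwise distinct entries such that y_ℓ − y_{ℓ'} ≠ −c for all ℓ ≠ ℓ'. Then the function x̄ ↦ K(x̄ | ȳ) / f(x̄, ȳ), defined for x̄ ∈ ℂ^p in a punctured neighborhood of ȳ with x_ℓ ≠ y_ℓ for every ℓ, tends to 1 as x̄ → ȳ; that is, the limit of K(x̄|ȳ)/f(x̄,ȳ) along the filter of neighborhoods of ȳ within the set { x̄ ∈ ℂ^p : x_ℓ ≠ y_ℓ for all ℓ } equals 1. -/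
open scoped BigOperators

/-- The extension of `izK c x y / fProd c x y` across the diagonal `x ℓ = y ℓ`. -/
noncomputable def izRatio (c : ℂ) {p : ℕ} (y x : Fin p → ℂ) : ℂ :=
  (∏ i : Fin p, ∏ j : Fin p, if i < j then c / (x j - x i) else 1) *
  (∏ i : Fin p, ∏ j : Fin p, if i < j then c / (y i - y j) else 1) *
  (∏ i : Fin p, ∏ j : Fin p, if i = j then 1 else (x i - y j) / c) *
  Matrix.det (Matrix.of fun i j : Fin p =>
    if i = j then c / (x i - y i + c)
    else (x i - y i) * (c / ((x i - y j) * (x i - y j + c))))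

theorem prod_offDiag_eq {M : Type*} [CommMonoid M] {p : ℕ} (a : Fin p → Fin p → M) :
    (∏ i, ∏ j, if i = j then 1 else a i j) =
      (∏ i, ∏ j, if i < j then a j i else 1) * ∏ i, ∏ j, if i < j then a i j else 1 := by
  rw [Finset.prod_comm (f := fun i j => if i < j then a j i else 1), ← Finset.prod_mul_distrib]
  refine Finset.prod_congr rfl fun i _ => ?_
  rw [← Finset.prod_mul_distrib]
  refine Finset.prod_congr rfl fun j _ => ?_
  rcases lt_trichotomy i j with h | h | h
  · simp [h, h.ne, h.not_gt]
  · simp [h]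
  · simp [h, h.ne', h.not_gt]

theorem izRatio_self {c : ℂ} (hc : c ≠ 0) {p : ℕ} {y : Fin p → ℂ} (hy : Function.Injective y) :
    izRatio c y y = 1 := by
  have hdet : (Matrix.of fun i j : Fin p =>
      if i = j then c / (y i - y i + c)
      else (y i - y i) * (c / ((y i - y j) * (y i - y j + c)))) = 1 := by
    ext i j
    by_cases h : i = j <;> simp [Matrix.one_apply, h, hc]
  rw [izRatio, hdet, Matrix.det_one, mul_one, prod_offDiag_eq, mul_mul_mul_comm]
  simp only [← Finset.prod_mul_distrib]
  have hpair : ∀ i j : Fin p, i < j → c / (y j - y i) * ((y j - y i) / c) = 1 ∧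
      c / (y i - y j) * ((y i - y j) / c) = 1 := fun i j h => by
    have h₁ : y j - y i ≠ 0 := sub_ne_zero.2 (hy.ne h.ne')
    have h₂ : y i - y j ≠ 0 := sub_ne_zero.2 (hy.ne h.ne)
    constructor <;> field_simp
  refine Finset.prod_eq_one fun i _ => Finset.prod_eq_one fun j _ => ?_
  split_ifs with h
  · rw [(hpair i j h).1, (hpair i j h).2, one_mul]
  · simp

theorem continuousAt_izRatio {c : ℂ} (hc : c ≠ 0) {p : ℕ} {y : Fin p → ℂ}
    (hy : Function.Injective y) (hyc : ∀ i j, y i - y j + c ≠ 0) :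
    ContinuousAt (izRatio c y) y := by
  have hne : ∀ i j, i ≠ j → y i - y j ≠ 0 := fun i j h => sub_ne_zero.2 (hy.ne h)
  have hx : ∀ i, ContinuousAt (fun x : Fin p → ℂ => x i) y := fun i =>
    (continuous_apply i).continuousAt
  refine ContinuousAt.mul (ContinuousAt.mul (ContinuousAt.mul ?_ continuousAt_const) ?_) ?_
  · refine tendsto_finsetProd _ fun i _ => tendsto_finsetProd _ fun j _ => ?_
    split_ifs with h
    · exact continuousAt_const.div ((hx j).sub (hx i)) (hne j i h.ne')
    · exact tendsto_const_nhds
  · refine tendsto_finsetProd _ fun i _ => tendsto_finsetProd _ fun j _ => ?_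
    split_ifs with h
    · exact tendsto_const_nhds
    · exact ((hx i).sub continuousAt_const).div continuousAt_const hc
  · refine (Continuous.matrix_det continuous_id).continuousAt.comp
      (continuousAt_pi.2 fun i => continuousAt_pi.2 fun j => ?_)
    simp only [Matrix.of_apply]
    split_ifs with h
    · exact continuousAt_const.div (((hx i).sub continuousAt_const).add continuousAt_const)
        (hyc i i)
    · have hd := (hx i).sub (continuousAt_const (y := y j))
      exact ((hx i).sub continuousAt_const).mul (continuousAt_const.div
        (hd.mul (hd.add continuousAt_const)) (mul_ne_zero (hne i j h) (hyc i j)))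

theorem izK_div_fProd_eq_izRatio {c : ℂ} (hc : c ≠ 0) {p : ℕ} {x y : Fin p → ℂ}
    (hxy : ∀ i j, x i - y j ≠ 0) (hxyc : ∀ i j, x i - y j + c ≠ 0) :
    izK c x y / fProd c x y = izRatio c y x := by
  have hprod : (∏ i, ∏ j, (x i - y j + c) / c) / fProd c x y =
      (∏ i : Fin p, ∏ j : Fin p, if i = j then 1 else (x i - y j) / c) *
        ∏ i, (x i - y i) / c := by
    rw [fProd, ← Finset.prod_div_distrib, ← Finset.prod_mul_distrib]
    refine Finset.prod_congr rfl fun i _ => ?_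
    rw [← Finset.prod_div_distrib, ← Fintype.prod_ite_eq i fun j => (x j - y j) / c,
      ← Finset.prod_mul_distrib]
    refine Finset.prod_congr rfl fun j _ => ?_
    have h₁ := hxy i j
    have h₂ := hxyc i j
    by_cases h : i = j
    · subst h
      simp only [if_true, one_mul]
      field_simp
    · simp only [h, if_false, mul_one]
      field_simp
  have hdet : (∏ i, (x i - y i) / c) *
      Matrix.det (Matrix.of fun i j : Fin p => (c / (x i - y j)) / ((x i - y j + c) / c)) =
      Matrix.det (Matrix.of fun i j : Fin p =>
        if i = j then c / (x i - y i + c)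
        else (x i - y i) * (c / ((x i - y j) * (x i - y j + c)))) := by
    rw [← Matrix.det_mul_column]
    congr 1
    ext i j
    have h₁ := hxy i j
    have h₂ := hxyc i j
    by_cases h : i = j
    · subst h
      simp only [Matrix.of_apply, if_true]
      field_simp
    · simp only [Matrix.of_apply, h, if_false]
      field_simp
  rw [izRatio, ← hdet, ← mul_assoc, mul_assoc _ _ (∏ i, (x i - y i) / c), ← hprod, izK]
  ring

/-- diagonal limit of the Izergin determinant:
`K(x̄|ȳ)/f(x̄,ȳ) → 1` as `x̄ → ȳ` within the set where `x_ℓ ≠ y_ℓ` for all `ℓ`. -/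
theorem izK_diagonal_limit (c : ℂ) (hc : c ≠ 0) (p : ℕ) (hp : 1 ≤ p)
    (y : Fin p → ℂ) (hy : Function.Injective y)
    (hyc : ∀ ℓ ℓ' : Fin p, ℓ ≠ ℓ' → y ℓ - y ℓ' ≠ -c) :
    Filter.Tendsto (fun x : Fin p → ℂ => izK c x y / fProd c x y)
      (nhdsWithin y {x : Fin p → ℂ | ∀ ℓ, x ℓ ≠ y ℓ}) (nhds 1) := by
  have hyc' : ∀ i j, y i - y j + c ≠ 0 := fun i j h => by
    rcases eq_or_ne i j with rfl | hij
    · exact hc (by simpa using h)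
    · exact hyc i j hij (eq_neg_of_add_eq_zero_left h)
  have hlim := (continuousAt_izRatio hc hy hyc').tendsto.mono_left
    (nhdsWithin_le_nhds (s := {x : Fin p → ℂ | ∀ ℓ, x ℓ ≠ y ℓ}))
  rw [izRatio_self hc hy] at hlim
  refine hlim.congr' ?_
  have hx : ∀ i, ContinuousAt (fun x : Fin p → ℂ => x i) y := fun i =>
    (continuous_apply i).continuousAt
  have hadd : ∀ᶠ x in nhds y, ∀ i j, x i - y j + c ≠ 0 :=
    Filter.eventually_all.2 fun i => Filter.eventually_all.2 fun j =>
      (((hx i).sub continuousAt_const).add continuousAt_const).eventually_ne (hyc' i j)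
  have hsub : ∀ᶠ x in nhds y, ∀ i j, i ≠ j → x i - y j ≠ 0 :=
    Filter.eventually_all.2 fun i => Filter.eventually_all.2 fun j =>
      Filter.eventually_all.2 fun h =>
        ((hx i).sub continuousAt_const).eventually_ne (sub_ne_zero.2 (hy.ne h))
  filter_upwards [nhdsWithin_le_nhds hadd, nhdsWithin_le_nhds hsub, self_mem_nhdsWithin]
    with x hxc hxs hxd
  refine (izK_div_fProd_eq_izRatio hc (fun i j => ?_) hxc).symm
  rcases eq_or_ne i j with rfl | h
  · exact sub_ne_zero.2 (hxd i)
  · exact hxs i j h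
end
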